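/- For every smooth scalar function f : ℝ³ → ℝ (ContDiff ℝ ⊤) and every natural number n ≥ 2, the n-th iterated Laplacian of g(x) = x₁² · f(x) satisfies Δⁿg = 4n(n−1) · ∂₁²(Δⁿ⁻²f) + 4n·x₁·∂₁(Δⁿ⁻¹f) + 2n·Δⁿ⁻¹f + x₁²·Δⁿf at every point x = (x₁, x₂, x₃) of ℝ³. -/

import Mathlib

/-- Partial derivative along the `i`-th coordinate direction in `ℝ³`. -/
noncomputable def pd (i : Fin 3) (f : (Fin 3 → ℝ) → ℝ) : (Fin 3 → ℝ) → ℝ :=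
  fun x => fderiv ℝ f x (Pi.single i 1)

/-- Scalar Laplacian `Δf = ∂₁²f + ∂₂²f + ∂₃²f`. -/
noncomputable def lap (f : (Fin 3 → ℝ) → ℝ) : (Fin 3 → ℝ) → ℝ :=
  fun x => pd 0 (pd 0 f) x + pd 1 (pd 1 f) x + pd 2 (pd 2 f) x

/-- Divergence of a vector field given by components. -/
noncomputable def div3 (F1 F2 F3 : (Fin 3 → ℝ) → ℝ) : (Fin 3 → ℝ) → ℝ :=
  fun x => pd 0 F1 x + pd 1 F2 x + pd 2 F3 x

/-- First component of the curl. -/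
noncomputable def curl1 (F1 F2 F3 : (Fin 3 → ℝ) → ℝ) : (Fin 3 → ℝ) → ℝ :=
  fun x => pd 1 F3 x - pd 2 F2 x

/-- Second component of the curl. -/
noncomputable def curl2 (F1 F2 F3 : (Fin 3 → ℝ) → ℝ) : (Fin 3 → ℝ) → ℝ :=
  fun x => pd 2 F1 x - pd 0 F3 x

/-- Third component of the curl. -/
noncomputable def curl3 (F1 F2 F3 : (Fin 3 → ℝ) → ℝ) : (Fin 3 → ℝ) → ℝ :=
  fun x => pd 0 F2 x - pd 1 F1 x

lemma ContDiff.pd {f : (Fin 3 → ℝ) → ℝ} (hf : ContDiff ℝ (⊤ : ℕ∞) f) (i : Fin 3) :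
    ContDiff ℝ (⊤ : ℕ∞) (pd i f) :=
  (hf.fderiv_right (by simp)).clm_apply contDiff_const

lemma ContDiff.lap {f : (Fin 3 → ℝ) → ℝ} (hf : ContDiff ℝ (⊤ : ℕ∞) f) :
    ContDiff ℝ (⊤ : ℕ∞) (lap f) :=
  (((hf.pd 0).pd 0).add ((hf.pd 1).pd 1)).add ((hf.pd 2).pd 2)

lemma ContDiff.lap_iterate {f : (Fin 3 → ℝ) → ℝ} (hf : ContDiff ℝ (⊤ : ℕ∞) f) (n : ℕ) :
    ContDiff ℝ (⊤ : ℕ∞) (_root_.lap^[n] f) := by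
  induction n with
  | zero => exact hf
  | succ n ih => rw [Function.iterate_succ_apply']; exact ih.lap

lemma pd_add {f g : (Fin 3 → ℝ) → ℝ} (hf : Differentiable ℝ f) (hg : Differentiable ℝ g)
    (i : Fin 3) : pd i (fun x => f x + g x) = fun x => pd i f x + pd i g x := by
  funext x
  simp [pd, fderiv_fun_add (hf x) (hg x)]

lemma pd_const_mul {f : (Fin 3 → ℝ) → ℝ} (hf : Differentiable ℝ f) (c : ℝ) (i : Fin 3) :
    pd i (fun x => c * f x) = fun x => c * pd i f x := by
  funext x
  simp [pd, fderiv_const_mul (hf x) c]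

lemma pd_coord_mul {f : (Fin 3 → ℝ) → ℝ} (hf : Differentiable ℝ f) (i j : Fin 3) :
    pd i (fun x => x j * f x) =
      fun x => x j * pd i f x + (Pi.single i 1 : Fin 3 → ℝ) j * f x := by
  funext x
  have h := ((hasFDerivAt_apply (𝕜 := ℝ) j x).fun_mul (hf x).hasFDerivAt).fderiv
  simp [pd, h, mul_comm (f x)]

lemma pd_comm {f : (Fin 3 → ℝ) → ℝ} (hf : ContDiff ℝ (⊤ : ℕ∞) f) (i j : Fin 3) :
    pd i (pd j f) = pd j (pd i f) := by
  have hd : Differentiable ℝ (fderiv ℝ f) :=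
    (hf.fderiv_right (m := (⊤ : ℕ∞)) (by simp)).differentiable (by simp)
  have key (k l : Fin 3) (x : Fin 3 → ℝ) :
      pd k (pd l f) x = fderiv ℝ (fderiv ℝ f) x (Pi.single k 1) (Pi.single l 1) := by
    unfold pd
    rw [fderiv_clm_apply (hd x) (differentiableAt_const _)]
    simp
  funext x
  rw [key, key]
  exact (hf.contDiffAt.isSymmSndFDerivAt
    (by rw [minSmoothness_of_isRCLikeNormedField]; exact WithTop.coe_le_coe.mpr le_top)) _ _

lemma lap_add {f g : (Fin 3 → ℝ) → ℝ} (hf : ContDiff ℝ (⊤ : ℕ∞) f)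
    (hg : ContDiff ℝ (⊤ : ℕ∞) g) : lap (fun x => f x + g x) = fun x => lap f x + lap g x := by
  have key (i : Fin 3) :
      pd i (pd i fun x => f x + g x) = fun x => pd i (pd i f) x + pd i (pd i g) x := by
    rw [pd_add (hf.differentiable (by simp)) (hg.differentiable (by simp)),
      pd_add ((hf.pd i).differentiable (by simp)) ((hg.pd i).differentiable (by simp))]
  funext x
  simp only [lap, key]
  ring

lemma lap_const_mul {f : (Fin 3 → ℝ) → ℝ} (hf : ContDiff ℝ (⊤ : ℕ∞) f) (c : ℝ) :
    lap (fun x => c * f x) = fun x => c * lap f x := by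
  have key (i : Fin 3) : pd i (pd i fun x => c * f x) = fun x => c * pd i (pd i f) x := by
    rw [pd_const_mul (hf.differentiable (by simp)),
      pd_const_mul ((hf.pd i).differentiable (by simp))]
  funext x
  simp only [lap, key]
  ring

lemma contDiff_coord_mul {f : (Fin 3 → ℝ) → ℝ} (hf : ContDiff ℝ (⊤ : ℕ∞) f) (j : Fin 3) :
    ContDiff ℝ (⊤ : ℕ∞) fun x : Fin 3 → ℝ => x j * f x :=
  (contDiff_apply ℝ ℝ j).mul hf

lemma lap_coord_mul {f : (Fin 3 → ℝ) → ℝ} (hf : ContDiff ℝ (⊤ : ℕ∞) f) (j : Fin 3) :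
    lap (fun x => x j * f x) = fun x => x j * lap f x + 2 * pd j f x := by
  have hd := hf.differentiable (by simp)
  have key (i : Fin 3) : pd i (pd i fun x => x j * f x) = fun x =>
      x j * pd i (pd i f) x + 2 * ((Pi.single i 1 : Fin 3 → ℝ) j * pd i f x) := by
    have hi := (hf.pd i).differentiable (by simp)
    rw [pd_coord_mul hd,
      pd_add ((contDiff_coord_mul (hf.pd i) j).differentiable (by simp)) (hd.const_mul _),
      pd_coord_mul hi, pd_const_mul hd]
    funext x
    ring
  funext x
  simp only [lap, key]
  fin_cases j <;> simp <;> ring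

lemma lap_pd {f : (Fin 3 → ℝ) → ℝ} (hf : ContDiff ℝ (⊤ : ℕ∞) f) (j : Fin 3) :
    lap (pd j f) = pd j (lap f) := by
  have key (i : Fin 3) : pd i (pd i (pd j f)) = pd j (pd i (pd i f)) := by
    rw [pd_comm hf i j, pd_comm (hf.pd i) i j]
  have h (i : Fin 3) : Differentiable ℝ (pd i (pd i f)) :=
    ((hf.pd i).pd i).differentiable (by simp)
  unfold lap
  rw [pd_add ((h 0).fun_add (h 1)) (h 2), pd_add (h 0) (h 1)]
  simp only [key]

/-- The commutator identity `Δⁿ(xⱼ f) = xⱼ Δⁿf + 2n ∂ⱼΔⁿ⁻¹f`. -/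
lemma lap_iterate_coord_mul {f : (Fin 3 → ℝ) → ℝ} (hf : ContDiff ℝ (⊤ : ℕ∞) f) (j : Fin 3)
    (n : ℕ) : lap^[n + 1] (fun x => x j * f x) =
      fun x => x j * lap^[n + 1] f x + 2 * (n + 1) * pd j (lap^[n] f) x := by
  induction n with
  | zero => simpa using lap_coord_mul hf j
  | succ n ih =>
    have h0 := hf.lap_iterate n
    have h1 := hf.lap_iterate (n + 1)
    rw [Function.iterate_succ_apply', ih,
      lap_add (contDiff_coord_mul h1 j) (contDiff_const.mul (h0.pd j)),
      lap_coord_mul h1, lap_const_mul (h0.pd j), lap_pd h0]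
    simp only [← Function.iterate_succ_apply' lap]
    funext x
    push_cast
    ring

theorem lap_iter_xsq_mul (f : (Fin 3 → ℝ) → ℝ) (hf : ContDiff ℝ (⊤ : ℕ∞) f)
    (n : ℕ) (hn : 2 ≤ n) :
    ∀ x : Fin 3 → ℝ,
      lap^[n] (fun y => (y 0) ^ 2 * f y) x
        = 4 * n * (n - 1 : ℝ) * pd 0 (pd 0 (lap^[n - 2] f)) x
          + 4 * n * x 0 * pd 0 (lap^[n - 1] f) x
          + 2 * n * lap^[n - 1] f x
          + (x 0) ^ 2 * lap^[n] f x := by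
  intro x
  obtain ⟨m, rfl⟩ := Nat.exists_eq_add_of_le' hn
  have hsq : (fun y : Fin 3 → ℝ => (y 0) ^ 2 * f y) = fun y => y 0 * (y 0 * f y) := by
    funext y
    ring
  have h0 := hf.lap_iterate m
  have h1 := hf.lap_iterate (m + 1)
  rw [hsq, lap_iterate_coord_mul (contDiff_coord_mul hf 0) 0 (m + 1),
    lap_iterate_coord_mul hf 0 (m + 1), lap_iterate_coord_mul hf 0 m,
    pd_add ((contDiff_coord_mul h1 0).differentiable (by simp))
      ((contDiff_const.mul (h0.pd 0)).differentiable (by simp)),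
    pd_coord_mul (h1.differentiable (by simp)),
    pd_const_mul ((h0.pd 0).differentiable (by simp))]
  simp only [Pi.single_eq_same, Nat.add_sub_cancel, show m + 2 - 1 = m + 1 from rfl]
  push_cast
  ring
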